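/- arXiv:2602.11035 — 5 statements merged into one kernel-verified Lean document; each statement's English description precedes it below -/
import Mathlib

section
/- For every term t in normal form, NF(t) = t; that is, every normal form is a fixed point of the normalizing map (Lemma 1). -/
/-- Terms over a signature `G` of generators: identities, generators,
sequential composition `⨟` and parallel composition `⊗`. -/
inductive PTerm (G : Type) : Type where
  | id : ℕ → PTerm G
  | gen : G → PTerm G
  | seq : PTerm G → PTerm G → PTerm G
  | par : PTerm G → PTerm G → PTerm G

namespace PTerm

variable {G : Type}

/-- Domain of a term. -/
def dom (domG : G → ℕ) : PTerm G → ℕ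
  | .id n => n
  | .gen g => domG g
  | .seq u _ => u.dom domG
  | .par u v => u.dom domG + v.dom domG

/-- Codomain of a term. -/
def cod (codG : G → ℕ) : PTerm G → ℕ
  | .id n => n
  | .gen g => codG g
  | .seq _ v => v.cod codG
  | .par u v => u.cod codG + v.cod codG

/-- Well-typedness of a term. -/
def WT (domG codG : G → ℕ) : PTerm G → Prop
  | .id _ => True
  | .gen _ => True
  | .seq u v => WT domG codG u ∧ WT domG codG v ∧ u.cod codG = v.dom domG
  | .par u v => WT domG codG u ∧ WT domG codG v

end PTerm

/-- A layer `⟨k, g, ℓ⟩ = id_k ⊗ (g ⊗ id_ℓ)`. -/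
def layer {G : Type} (k : ℕ) (g : G) (ℓ : ℕ) : PTerm G :=
  .par (.id k) (.par (.gen g) (.id ℓ))

/-- The set `pp(Σ)` of preprocessed terms: the smallest set of well-typed terms
containing all identities and all layers and closed under `⨟` and `⊗`. -/
inductive PP {G : Type} (domG codG : G → ℕ) : PTerm G → Prop where
  | protected id (n : ℕ) : PP domG codG (.id n)
  | protected layer (k : ℕ) (g : G) (ℓ : ℕ) : PP domG codG (layer k g ℓ)
  | protected seq {u v : PTerm G} : PP domG codG u → PP domG codG v →
      u.cod codG = v.dom domG → PP domG codG (.seq u v)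
  | protected par {u v : PTerm G} : PP domG codG u → PP domG codG v →
      PP domG codG (.par u v)

/-- `NFSeq domG codG h t` : `t` is a well-typed sequence of layers in normal form whose
first layer `⟨k₁, g₁, ℓ₁⟩` has height `h = k₁ + dom g₁`. -/
inductive NFSeq {G : Type} (domG codG : G → ℕ) : ℕ → PTerm G → Prop where
  | single (k : ℕ) (g : G) (ℓ : ℕ) : NFSeq domG codG (k + domG g) (layer k g ℓ)
  | cons (k : ℕ) (g : G) (ℓ : ℕ) {h : ℕ} {t : PTerm G} :
      NFSeq domG codG h t → k < h →
      (layer k g ℓ : PTerm G).cod codG = t.dom domG →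
      NFSeq domG codG (k + domG g) (.seq (layer k g ℓ) t)

/-- The set `NF(Σ)` of terms in normal form. -/
def IsNF {G : Type} (domG codG : G → ℕ) (t : PTerm G) : Prop :=
  (∃ n, t = .id n) ∨ ∃ h, NFSeq domG codG h t

/-- Inserting a single layer `⟨k', g', ℓ'⟩` into a sequence of layers:
the single-layer case of the `•` operation of Definition 2. -/
def insertLayer {G : Type} (domG codG : G → ℕ) (k' : ℕ) (g' : G) (ℓ' : ℕ) :
    List (ℕ × G × ℕ) → List (ℕ × G × ℕ)
  | [] => [(k', g', ℓ')]
  | (k, g, ℓ) :: rest =>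
      if k' < k + domG g then (k', g', ℓ') :: (k, g, ℓ) :: rest
      else (k, g, ℓ + codG g' - domG g') ::
        insertLayer domG codG (k' + domG g - codG g) g' ℓ' rest

/-- The `•` operation of Definition 2 on layer sequences. -/
def bulletList {G : Type} (domG codG : G → ℕ)
    (ls rs : List (ℕ × G × ℕ)) : List (ℕ × G × ℕ) :=
  ls.foldr (fun l acc => insertLayer domG codG l.1 l.2.1 l.2.2 acc) rs

/-- Representation of normal forms: an identity or a (nonempty) sequence of layers,
each layer given by its upper width, generator and lower width. -/
inductive NFRep (G : Type) : Type where
  | id : ℕ → NFRep G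
  | seq : List (ℕ × G × ℕ) → NFRep G

/-- Domain of a sequence of layers. -/
def listDom {G : Type} (domG : G → ℕ) : List (ℕ × G × ℕ) → ℕ
  | [] => 0
  | (k, g, ℓ) :: _ => k + domG g + ℓ

/-- Codomain of a sequence of layers. -/
def listCod {G : Type} (codG : G → ℕ) : List (ℕ × G × ℕ) → ℕ
  | [] => 0
  | [(k, g, ℓ)] => k + codG g + ℓ
  | _ :: rest => listCod codG rest

/-- The `•` operation of Definition 2. -/
def bullet {G : Type} (domG codG : G → ℕ) : NFRep G → NFRep G → NFRep G
  | .id n, .id _ => .id n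
  | .id _, .seq rs => .seq rs
  | .seq ls, .id _ => .seq ls
  | .seq ls, .seq rs => .seq (bulletList domG codG ls rs)

/-- The `⋆` operation of Definition 2. -/
def star {G : Type} (domG codG : G → ℕ) : NFRep G → NFRep G → NFRep G
  | .id n, .id m => .id (n + m)
  | .id n, .seq rs => .seq (rs.map (fun l => (l.1 + n, l.2.1, l.2.2)))
  | .seq ls, .id n => .seq (ls.map (fun l => (l.1, l.2.1, l.2.2 + n)))
  | .seq ls, .seq rs =>
      .seq (ls.map (fun l => (l.1, l.2.1, l.2.2 + listDom domG rs)) ++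
            rs.map (fun l => (l.1 + listCod codG ls, l.2.1, l.2.2)))

/-- The normalizing map, on representations. -/
def NFr {G : Type} (domG codG : G → ℕ) : PTerm G → NFRep G
  | .id n => .id n
  | .gen g => .seq [(0, g, 0)]
  | .seq u v => bullet domG codG (NFr domG codG u) (NFr domG codG v)
  | .par u v => star domG codG (NFr domG codG u) (NFr domG codG v)

/-- Turning a sequence of layers back into a term. -/
def layersToTerm {G : Type} : List (ℕ × G × ℕ) → PTerm G
  | [] => .id 0
  | [(k, g, ℓ)] => layer k g ℓ
  | (k, g, ℓ) :: rest => .seq (layer k g ℓ) (layersToTerm rest)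

/-- The normalizing map `NF : terms → NF(Σ)` of Definition 2. -/
def NFmap {G : Type} (domG codG : G → ℕ) (t : PTerm G) : PTerm G :=
  match NFr domG codG t with
  | .id n => .id n
  | .seq ls => layersToTerm ls

/-- One-step rewriting with the TRS `R` (rules R1–R11, closed under subterm contexts).
The integer quantities `ℓ₂ + def g₁` and `k₁ - def g₂` of rules R10/R11 are written with
truncated subtraction; they agree with the intended values on well-typed terms. -/
inductive Step {G : Type} (domG codG : G → ℕ) : PTerm G → PTerm G → Prop where
  | r1 (t u v : PTerm G) : Step domG codG (.seq (.seq t u) v) (.seq t (.seq u v))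
  | r2 (t u v : PTerm G) : Step domG codG (.par (.par t u) v) (.par t (.par u v))
  | r3 (n : ℕ) (t : PTerm G) : Step domG codG (.seq (.id n) t) t
  | r4 (n : ℕ) (t : PTerm G) : Step domG codG (.seq t (.id n)) t
  | r5 (n m : ℕ) : Step domG codG (.par (.id n) (.id m)) (.id (n + m))
  | r6 (n m : ℕ) (t : PTerm G) :
      Step domG codG (.par (.id n) (.par (.id m) t)) (.par (.id (n + m)) t)
  | r7 (u v : PTerm G) : (∀ n, u ≠ .id n) → (∀ n, v ≠ .id n) →
      Step domG codG (.par u v)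
        (.seq (.par u (.id (v.dom domG))) (.par (.id (u.cod codG)) v))
  | r8 (n : ℕ) (u v : PTerm G) :
      Step domG codG (.par (.id n) (.seq u v))
        (.seq (.par (.id n) u) (.par (.id n) v))
  | r9 (n : ℕ) (u v : PTerm G) :
      Step domG codG (.par (.seq u v) (.id n))
        (.seq (.par u (.id n)) (.par v (.id n)))
  | r10 (k₁ k₂ ℓ₁ ℓ₂ : ℕ) (g₁ g₂ : G) (h : k₁ ≥ k₂ + domG g₂) :
      Step domG codG (.seq (layer k₁ g₁ ℓ₁) (layer k₂ g₂ ℓ₂))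
        (.seq (layer k₂ g₂ (ℓ₂ + codG g₁ - domG g₁))
              (layer (k₁ + domG g₂ - codG g₂) g₁ ℓ₁))
  | r11 (k₁ k₂ ℓ₁ ℓ₂ : ℕ) (g₁ g₂ : G) (t : PTerm G) (h : k₁ ≥ k₂ + domG g₂) :
      Step domG codG (.seq (layer k₁ g₁ ℓ₁) (.seq (layer k₂ g₂ ℓ₂) t))
        (.seq (layer k₂ g₂ (ℓ₂ + codG g₁ - domG g₁))
              (.seq (layer (k₁ + domG g₂ - codG g₂) g₁ ℓ₁) t))
  | seqL {u u' : PTerm G} (v : PTerm G) :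
      Step domG codG u u' → Step domG codG (.seq u v) (.seq u' v)
  | seqR (u : PTerm G) {v v' : PTerm G} :
      Step domG codG v v' → Step domG codG (.seq u v) (.seq u v')
  | parL {u u' : PTerm G} (v : PTerm G) :
      Step domG codG u u' → Step domG codG (.par u v) (.par u' v)
  | parR (u : PTerm G) {v v' : PTerm G} :
      Step domG codG v v' → Step domG codG (.par u v) (.par u v')

/-- Zero or more rewrite steps of `R`. -/
def Steps {G : Type} (domG codG : G → ℕ) : PTerm G → PTerm G → Prop :=
  Relation.ReflTransGen (Step domG codG)

/-- Provable equality in the PRO `PRO_Σ`: the smallest congruence (for `⨟` and `⊗`)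
containing the PRO coherence equations. -/
inductive ProEq {G : Type} (domG codG : G → ℕ) : PTerm G → PTerm G → Prop where
  | refl (t : PTerm G) : ProEq domG codG t t
  | symm {t u : PTerm G} : ProEq domG codG t u → ProEq domG codG u t
  | trans {t u v : PTerm G} :
      ProEq domG codG t u → ProEq domG codG u v → ProEq domG codG t v
  | seqCongr {u u' v v' : PTerm G} : ProEq domG codG u u' → ProEq domG codG v v' →
      ProEq domG codG (.seq u v) (.seq u' v')
  | parCongr {u u' v v' : PTerm G} : ProEq domG codG u u' → ProEq domG codG v v' →
      ProEq domG codG (.par u v) (.par u' v')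
  | seqAssoc (t u v : PTerm G) :
      ProEq domG codG (.seq (.seq t u) v) (.seq t (.seq u v))
  | seqIdLeft (t : PTerm G) : ProEq domG codG (.seq (.id (t.dom domG)) t) t
  | seqIdRight (t : PTerm G) : ProEq domG codG (.seq t (.id (t.cod codG))) t
  | parAssoc (t u v : PTerm G) :
      ProEq domG codG (.par (.par t u) v) (.par t (.par u v))
  | parIdLeft (t : PTerm G) : ProEq domG codG (.par (.id 0) t) t
  | parIdRight (t : PTerm G) : ProEq domG codG (.par t (.id 0)) t
  | idId (n m : ℕ) : ProEq domG codG (.par (.id n) (.id m)) (.id (n + m))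
  | interchange (u v u' v' : PTerm G) :
      ProEq domG codG (.par (.seq u v) (.seq u' v')) (.seq (.par u u') (.par v v'))

/-- The termination measure `β`. -/
def beta {G : Type} : PTerm G → ℕ
  | .id _ => 2
  | .gen _ => 5
  | .seq u v => 2 * beta u + beta v + 1
  | .par u v => beta u ^ 2 * beta v

/-- The termination measure `δ_D`. -/
noncomputable def delta {G : Type} (D : ℕ) : PTerm G → ℝ
  | .id _ => 0
  | .gen _ => 0
  | .seq u v => delta D u + delta D v / D
  | .par (.id n) v => (n : ℝ) + delta D v
  | .par (.gen g) v => delta D (.gen g) + delta D v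
  | .par (.seq u₁ u₂) v => delta D (.seq u₁ u₂) + delta D v
  | .par (.par u₁ u₂) v => delta D (.par u₁ u₂) + delta D v
  termination_by t => sizeOf t
  decreasing_by all_goals (simp_wf <;> omega)

/-- `D(t) = 2 + max_{g ∈ gen(t)} |def(g)|` (and `2` if no generator occurs in `t`). -/
def Dbound {G : Type} (domG codG : G → ℕ) : PTerm G → ℕ
  | .id _ => 2
  | .gen g => 2 + ((codG g : ℤ) - (domG g : ℤ)).natAbs
  | .seq u v => max (Dbound domG codG u) (Dbound domG codG v)
  | .par u v => max (Dbound domG codG u) (Dbound domG codG v)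

theorem NFr_layer {G : Type} (domG codG : G → ℕ) (k : ℕ) (g : G) (ℓ : ℕ) :
    NFr domG codG (layer k g ℓ) = .seq [(k, g, ℓ)] := by
  simp [NFr, layer, _root_.star.eq_def]

theorem NFSeq.exists_NFr_eq {G : Type} {domG codG : G → ℕ} {h : ℕ} {t : PTerm G}
    (ht : NFSeq domG codG h t) :
    ∃ k g ℓ ls, NFr domG codG t = .seq ((k, g, ℓ) :: ls) ∧ k + domG g = h ∧
      layersToTerm ((k, g, ℓ) :: ls) = t := by
  induction ht with
  | single k g ℓ => exact ⟨k, g, ℓ, [], NFr_layer domG codG k g ℓ, rfl, rfl⟩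
  | cons k g ℓ _ hlt _ ih =>
    obtain ⟨k₁, g₁, ℓ₁, ls, hNF, rfl, rfl⟩ := ih
    refine ⟨k, g, ℓ, (k₁, g₁, ℓ₁) :: ls, ?_, rfl, rfl⟩
    simp [NFr, NFr_layer, hNF, bullet, bulletList, insertLayer, hlt]

/-- Lemma 1: every normal form is a fixed point of the normalizing map. -/
theorem nf_fixed_point {G : Type} (domG codG : G → ℕ)
    (hSig : ∀ g : G, 0 < domG g ∧ 0 < codG g)
    (t : PTerm G) (ht : IsNF domG codG t) :
    NFmap domG codG t = t := by
  obtain ⟨n, rfl⟩ | ⟨h, hseq⟩ := ht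
  · rfl
  · obtain ⟨k, g, ℓ, ls, hNF, -, hterm⟩ := hseq.exists_NFr_eq
    simpa only [NFmap, hNF] using hterm
end

section
/- The rewriting system R terminates: there is no infinite rewrite sequence t₁ → t₂ → t₃ → … of single R-steps; equivalently, the converse of the one-step rewrite relation of R is well-founded (Proposition 2). -/
namespace PTerm

variable {G : Type}

/-- The number of sequential compositions in a term. -/
def seqCount : PTerm G → ℕ
  | .id _ => 0
  | .gen _ => 0
  | .seq u v => seqCount u + seqCount v + 1
  | .par u v => seqCount u + seqCount v

/-- The width of an identity, and `0` for every other term. -/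
def idWidth : PTerm G → ℕ
  | .id n => n
  | _ => 0

/-- The measure `δ_D` for `D = 2`, cleared of denominators: `2 ^ seqCount t * δ₂ t`. -/
def scaledDelta : PTerm G → ℕ
  | .id _ => 0
  | .gen _ => 0
  | .seq u v => 2 ^ (seqCount v + 1) * scaledDelta u + 2 ^ seqCount u * scaledDelta v
  | .par u v => 2 ^ (seqCount u + seqCount v) * idWidth u +
      2 ^ seqCount v * scaledDelta u + 2 ^ seqCount u * scaledDelta v

end PTerm

open PTerm

theorem two_le_beta {G : Type} (t : PTerm G) : 2 ≤ beta t := by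
  induction t with
  | id n => simp [beta]
  | gen g => simp [beta]
  | seq u v hu hv => simp only [beta]; omega
  | par u v hu hv => simp only [beta]; nlinarith [Nat.mul_le_mul hu hu]

theorem five_le_beta {G : Type} (t : PTerm G) (ht : ∀ n, t ≠ .id n) : 5 ≤ beta t := by
  cases t with
  | id n => exact absurd rfl (ht n)
  | gen g => simp [beta]
  | seq u v =>
    have := two_le_beta u
    have := two_le_beta v
    simp only [beta]; omega
  | par u v =>
    have hu := two_le_beta u
    have hv := two_le_beta v
    simp only [beta]; nlinarith [Nat.mul_le_mul hu hu]

/-- A rewrite step either decreases `beta`, or preserves it and decreases `scaledDelta`. -/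
theorem Step.beta_lt_or_scaledDelta_lt {G : Type} {domG codG : G → ℕ}
    (hSig : ∀ g : G, 0 < domG g ∧ 0 < codG g) {t t' : PTerm G} (h : Step domG codG t t') :
    beta t' < beta t ∨ (beta t' = beta t ∧ seqCount t' = seqCount t ∧
      idWidth t' = idWidth t ∧ scaledDelta t' < scaledDelta t) := by
  induction h with
  | r1 t u v =>
    left
    have := two_le_beta t
    simp only [beta]; omega
  | r2 t u v =>
    left
    have ht := two_le_beta t
    have hu := two_le_beta u
    have hv := two_le_beta v
    have hpos : 0 < beta t ^ 2 * (beta u ^ 2 * beta v) := by positivity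
    have ht2 : 4 ≤ beta t ^ 2 := by nlinarith
    simp only [beta]
    calc beta t ^ 2 * (beta u ^ 2 * beta v)
        < 4 * (beta t ^ 2 * (beta u ^ 2 * beta v)) := by omega
      _ ≤ beta t ^ 2 * (beta t ^ 2 * (beta u ^ 2 * beta v)) := Nat.mul_le_mul_right _ ht2
      _ = (beta t ^ 2 * beta u) ^ 2 * beta v := by ring
  | r3 n t => left; simp only [beta]; omega
  | r4 n t => left; simp only [beta]; omega
  | r5 n m => left; simp [beta]
  | r6 n m t =>
    left
    have := two_le_beta t
    simp only [beta]; omega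
  | r7 u v hu hv =>
    left
    have hu' := five_le_beta u hu
    have hv' := five_le_beta v hv
    have hu2 : 25 ≤ beta u ^ 2 := by nlinarith
    simp only [beta]; nlinarith
  | r8 n u v => left; simp only [beta]; omega
  | r9 n u v =>
    left
    simp only [beta]
    ring_nf
    nlinarith [Nat.zero_le (beta u * beta v), Nat.zero_le (beta u ^ 2)]
  | r10 k₁ k₂ ℓ₁ ℓ₂ g₁ g₂ h =>
    right
    have := hSig g₂
    refine ⟨by simp [beta, layer], by simp [seqCount, layer], rfl, ?_⟩
    simp only [scaledDelta, seqCount, idWidth, layer]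
    omega
  | r11 k₁ k₂ ℓ₁ ℓ₂ g₁ g₂ t h =>
    right
    have := hSig g₂
    refine ⟨by simp [beta, layer], by simp [seqCount, layer], rfl, ?_⟩
    have hk : 2 * k₂ + (k₁ + domG g₂ - codG g₂) < 2 * k₁ + k₂ := by omega
    have := Nat.mul_lt_mul_of_pos_left hk (Nat.two_pow_pos (seqCount t + 1))
    simp only [scaledDelta, seqCount, idWidth, layer]
    ring_nf at this ⊢
    omega
  | @seqL u u' v _ ih =>
    rcases ih with ih | ⟨hb, hs, -, hd⟩
    · left; simp only [beta]; omega
    · right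
      refine ⟨by simp [beta, hb], by simp [seqCount, hs], rfl, ?_⟩
      simp only [scaledDelta, hs]
      gcongr
  | @seqR u v v' _ ih =>
    rcases ih with ih | ⟨hb, hs, -, hd⟩
    · left; simp only [beta]; omega
    · right
      refine ⟨by simp [beta, hb], by simp [seqCount, hs], rfl, ?_⟩
      simp only [scaledDelta, hs]
      gcongr
  | @parL u u' v _ ih =>
    rcases ih with ih | ⟨hb, hs, hi, hd⟩
    · left
      have hv := two_le_beta v
      simp only [beta]
      gcongr
    · right
      refine ⟨by simp [beta, hb], by simp [seqCount, hs], rfl, ?_⟩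
      simp only [scaledDelta, hs, hi]
      gcongr
  | @parR u v v' _ ih =>
    rcases ih with ih | ⟨hb, hs, -, hd⟩
    · left
      have hu := two_le_beta u
      simp only [beta]
      gcongr
    · right
      refine ⟨by simp [beta, hb], by simp [seqCount, hs], rfl, ?_⟩
      simp only [scaledDelta, hs]
      gcongr

/-- Proposition 2: the TRS `R` terminates, i.e. the converse of its one-step
rewrite relation is well-founded. -/
theorem termination {G : Type} (domG codG : G → ℕ)
    (hSig : ∀ g : G, 0 < domG g ∧ 0 < codG g) :
    WellFounded (fun t₁ t₂ : PTerm G => Step domG codG t₂ t₁) := by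
  refine Subrelation.wf (r := InvImage (Prod.Lex (· < ·) (· < ·))
    (fun t : PTerm G => (beta t, scaledDelta t))) ?_
    (InvImage.wf _ (WellFounded.prod_lex wellFounded_lt wellFounded_lt))
  intro t' t h
  rcases h.beta_lt_or_scaledDelta_lt hSig with hb | ⟨hb, -, -, hd⟩
  · exact Prod.Lex.left _ _ hb
  · exact Prod.lex_def.2 (Or.inr ⟨hb, hd⟩)
end

section
/- Every preprocessed term that is irreducible with respect to R is in normal form: for all t ∈ pp(Σ), if no R-rewrite step applies to t (at the root or in any subterm) then t ∈ NF(Σ) (Lemma 3). -/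
/-- A parallel composition of two normal forms is reducible. -/
theorem exists_step_par {G : Type} {domG codG : G → ℕ} {u v : PTerm G}
    (hu : IsNF domG codG u) (hv : IsNF domG codG v) :
    ∃ w, Step domG codG (.par u v) w := by
  rcases hu with ⟨n, rfl⟩ | ⟨_, ⟨k, g, ℓ⟩ | ⟨k, g, ℓ, _, _, _⟩⟩
  · rcases hv with ⟨m, rfl⟩ | ⟨_, ⟨k, g, ℓ⟩ | ⟨k, g, ℓ, _, _, _⟩⟩
    · exact ⟨_, .r5 n m⟩
    · exact ⟨_, .r6 n k _⟩
    · exact ⟨_, .r8 n _ _⟩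
  · exact ⟨_, .r2 _ _ v⟩
  · by_cases h : ∃ n, v = .id n
    · obtain ⟨n, rfl⟩ := h
      exact ⟨_, .r9 n _ _⟩
    · exact ⟨_, .r7 _ v nofun (not_exists.mp h)⟩

/-- An irreducible sequential composition of two normal forms is a normal form. -/
theorem IsNF.seq_of_irreducible {G : Type} {domG codG : G → ℕ} {u v : PTerm G}
    (hu : IsNF domG codG u) (hv : IsNF domG codG v) (huv : u.cod codG = v.dom domG)
    (hirr : ∀ w, ¬ Step domG codG (.seq u v) w) :
    IsNF domG codG (.seq u v) := by
  rcases hv with ⟨m, rfl⟩ | ⟨h, hv⟩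
  · exact (hirr _ (.r4 m u)).elim
  rcases hu with ⟨n, rfl⟩ | ⟨_, ⟨k, g, ℓ⟩ | ⟨k, g, ℓ, _, _, _⟩⟩
  · exact (hirr _ (.r3 n v)).elim
  · refine Or.inr ⟨_, .cons k g ℓ hv ?_ huv⟩
    by_contra! hle
    cases hv with
    | single k₂ g₂ ℓ₂ => exact hirr _ (.r10 k k₂ ℓ ℓ₂ g g₂ hle)
    | cons k₂ g₂ ℓ₂ _ _ _ => exact hirr _ (.r11 k k₂ ℓ ℓ₂ g g₂ _ hle)
  · exact (hirr _ (.r1 _ _ v)).elim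

/-- Lemma 3: every irreducible preprocessed term is in normal form. -/
theorem irreducible_is_nf {G : Type} (domG codG : G → ℕ)
    (hSig : ∀ g : G, 0 < domG g ∧ 0 < codG g)
    (t : PTerm G) (ht : PP domG codG t)
    (hirr : ∀ u : PTerm G, ¬ Step domG codG t u) :
    IsNF domG codG t := by
  induction ht with
  | id n => exact Or.inl ⟨n, rfl⟩
  | layer k g ℓ => exact Or.inr ⟨_, .single k g ℓ⟩
  | @seq u v _ _ huv ihu ihv =>
    exact (ihu fun _ h => hirr _ (.seqL v h)).seq_of_irreducible
      (ihv fun _ h => hirr _ (.seqR u h)) huv hirr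
  | @par u v _ _ ihu ihv =>
    obtain ⟨w, hw⟩ := exists_step_par (ihu fun _ h => hirr _ (.parL v h))
      (ihv fun _ h => hirr _ (.parR u h))
    exact (hirr w hw).elim
end

section
/- For all preprocessed terms t₁, t₂, if NF(t₁) = NF(t₂) then t₁ and t₂ are joinable by R: there exists a term u such that t₁ rewrites to u and t₂ rewrites to u in zero or more R-steps; in particular t₁ can be transformed into t₂ by applying R-steps forwards and backwards (main Theorem). -/
section Joinability

variable {G : Type} {domG codG : G → ℕ}

lemma Steps.seq_congr {u u' v v' : PTerm G} (hu : Steps domG codG u u')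
    (hv : Steps domG codG v v') : Steps domG codG (.seq u v) (.seq u' v') :=
  (Relation.ReflTransGen.lift (PTerm.seq · v) (fun _ _ h => Step.seqL v h) _ _ hu).trans
    (Relation.ReflTransGen.lift (PTerm.seq u') (fun _ _ h => Step.seqR u' h) _ _ hv)

lemma Steps.par_congr {u u' v v' : PTerm G} (hu : Steps domG codG u u')
    (hv : Steps domG codG v v') : Steps domG codG (.par u v) (.par u' v') :=
  (Relation.ReflTransGen.lift (PTerm.par · v) (fun _ _ h => Step.parL v h) _ _ hu).trans
    (Relation.ReflTransGen.lift (PTerm.par u') (fun _ _ h => Step.parR u' h) _ _ hv)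

lemma layersToTerm_cons (l : ℕ × G × ℕ) {ls : List (ℕ × G × ℕ)} (hls : ls ≠ []) :
    layersToTerm (l :: ls) = .seq (layer l.1 l.2.1 l.2.2) (layersToTerm ls) := by
  cases ls with
  | nil => exact absurd rfl hls
  | cons => rfl

lemma layersToTerm_ne_id {ls : List (ℕ × G × ℕ)} (hls : ls ≠ []) (n : ℕ) :
    layersToTerm ls ≠ .id n := by
  match ls, hls with
  | [_], _ => simp [layersToTerm, layer]
  | _ :: _ :: _, _ => simp [layersToTerm]

lemma dom_layersToTerm (ls : List (ℕ × G × ℕ)) :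
    (layersToTerm ls).dom domG = listDom domG ls := by
  match ls with
  | [] => rfl
  | [_] => simp [layersToTerm, layer, PTerm.dom, listDom, Nat.add_assoc]
  | _ :: _ :: _ => simp [layersToTerm, layer, PTerm.dom, listDom, Nat.add_assoc]

lemma cod_layersToTerm (ls : List (ℕ × G × ℕ)) :
    (layersToTerm ls).cod codG = listCod codG ls := by
  match ls with
  | [] => rfl
  | [_] => simp [layersToTerm, layer, PTerm.cod, listCod, Nat.add_assoc]
  | _ :: l :: ls => simpa [layersToTerm, PTerm.cod, listCod] using cod_layersToTerm (l :: ls)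

lemma insertLayer_ne_nil (k : ℕ) (g : G) (ℓ : ℕ) (rs : List (ℕ × G × ℕ)) :
    insertLayer domG codG k g ℓ rs ≠ [] := by
  cases rs with
  | nil => simp [insertLayer]
  | cons => rw [insertLayer]; split <;> simp

lemma bulletList_ne_nil (ls : List (ℕ × G × ℕ)) {rs : List (ℕ × G × ℕ)} (hrs : rs ≠ []) :
    bulletList domG codG ls rs ≠ [] := by
  cases ls with
  | nil => exact hrs
  | cons => exact insertLayer_ne_nil _ _ _ _

lemma steps_insertLayer (k : ℕ) (g : G) (ℓ : ℕ) {rs : List (ℕ × G × ℕ)} (hrs : rs ≠ []) :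
    Steps domG codG (.seq (layer k g ℓ) (layersToTerm rs))
      (layersToTerm (insertLayer domG codG k g ℓ rs)) := by
  induction rs generalizing k with
  | nil => exact absurd rfl hrs
  | cons r rest ih =>
    obtain ⟨k₂, g₂, ℓ₂⟩ := r
    rw [insertLayer]
    split
    · exact .refl
    · rename_i hk
      rw [layersToTerm_cons _ (insertLayer_ne_nil _ _ _ _)]
      by_cases hrest : rest = []
      · subst hrest
        exact .single (Step.r10 _ _ _ _ _ _ (not_lt.mp hk))
      · rw [layersToTerm_cons _ hrest]
        exact .head (Step.r11 _ _ _ _ _ _ _ (not_lt.mp hk))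
          (Steps.seq_congr .refl (ih _ hrest))

lemma steps_bulletList {ls rs : List (ℕ × G × ℕ)} (hls : ls ≠ []) (hrs : rs ≠ []) :
    Steps domG codG (.seq (layersToTerm ls) (layersToTerm rs))
      (layersToTerm (bulletList domG codG ls rs)) := by
  induction ls with
  | nil => exact absurd rfl hls
  | cons l rest ih =>
    have insert_l := steps_insertLayer (domG := domG) (codG := codG) l.1 l.2.1 l.2.2
      (bulletList_ne_nil (domG := domG) (codG := codG) rest hrs)
    by_cases hrest : rest = []
    · subst hrest
      exact insert_l
    · rw [layersToTerm_cons _ hrest]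
      exact .head (Step.r1 _ _ _) ((Steps.seq_congr .refl (ih hrest)).trans insert_l)

lemma steps_append {ls rs : List (ℕ × G × ℕ)} (hls : ls ≠ []) (hrs : rs ≠ []) :
    Steps domG codG (.seq (layersToTerm ls) (layersToTerm rs)) (layersToTerm (ls ++ rs)) := by
  induction ls with
  | nil => exact absurd rfl hls
  | cons l rest ih =>
    rw [List.cons_append, layersToTerm_cons l (ls := rest ++ rs) (by simp [hrs])]
    by_cases hrest : rest = []
    · subst hrest
      exact .refl
    · rw [layersToTerm_cons _ hrest]
      exact .head (Step.r1 _ _ _) (Steps.seq_congr .refl (ih hrest))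

lemma steps_id_par_layer (n k : ℕ) (g : G) (ℓ : ℕ) :
    Steps domG codG (.par (.id n) (layer k g ℓ)) (layer (k + n) g ℓ) := by
  rw [Nat.add_comm]
  exact .single (Step.r6 _ _ _)

lemma steps_layer_par_id (n k : ℕ) (g : G) (ℓ : ℕ) :
    Steps domG codG (.par (layer k g ℓ) (.id n)) (layer k g (ℓ + n)) :=
  .head (Step.r2 _ _ _) (.head (Step.parR _ (Step.r2 _ _ _))
    (.single (Step.parR _ (Step.parR _ (Step.r5 _ _)))))

lemma steps_id_par (n : ℕ) {ls : List (ℕ × G × ℕ)} (hls : ls ≠ []) :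
    Steps domG codG (.par (.id n) (layersToTerm ls))
      (layersToTerm (ls.map (fun l => (l.1 + n, l.2.1, l.2.2)))) := by
  induction ls with
  | nil => exact absurd rfl hls
  | cons l rest ih =>
    by_cases hrest : rest = []
    · subst hrest
      exact steps_id_par_layer ..
    · rw [List.map_cons, layersToTerm_cons _ hrest, layersToTerm_cons _ (by simp [hrest])]
      exact .head (Step.r8 _ _ _) (Steps.seq_congr (steps_id_par_layer ..) (ih hrest))

lemma steps_par_id (n : ℕ) {ls : List (ℕ × G × ℕ)} (hls : ls ≠ []) :
    Steps domG codG (.par (layersToTerm ls) (.id n))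
      (layersToTerm (ls.map (fun l => (l.1, l.2.1, l.2.2 + n)))) := by
  induction ls with
  | nil => exact absurd rfl hls
  | cons l rest ih =>
    by_cases hrest : rest = []
    · subst hrest
      exact steps_layer_par_id ..
    · rw [List.map_cons, layersToTerm_cons _ hrest, layersToTerm_cons _ (by simp [hrest])]
      exact .head (Step.r9 _ _ _) (Steps.seq_congr (steps_layer_par_id ..) (ih hrest))

/-- The term denoted by a representation of a normal form. -/
def NFRep.toTerm : NFRep G → PTerm G
  | .id n => .id n
  | .seq ls => layersToTerm ls

lemma NFmap_eq_toTerm (t : PTerm G) : NFmap domG codG t = (NFr domG codG t).toTerm := by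
  rw [NFmap]
  cases NFr domG codG t <;> rfl

lemma bullet_ne_seq_nil {a b : NFRep G} (ha : a ≠ .seq []) (hb : b ≠ .seq []) :
    bullet domG codG a b ≠ .seq [] := by
  cases a <;> cases b <;> simp_all [bullet, bulletList_ne_nil]

lemma star_ne_seq_nil {a b : NFRep G} (ha : a ≠ .seq []) (hb : b ≠ .seq []) :
    star domG codG a b ≠ .seq [] := by
  cases a <;> cases b <;> simp_all [_root_.star]

lemma steps_bullet {a b : NFRep G} (ha : a ≠ .seq []) (hb : b ≠ .seq []) :
    Steps domG codG (.seq a.toTerm b.toTerm) (bullet domG codG a b).toTerm := by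
  cases a with
  | id n =>
    cases b with
    | id m => exact .single (Step.r4 _ _)
    | seq rs => exact .single (Step.r3 _ _)
  | seq ls =>
    cases b with
    | id m => exact .single (Step.r4 _ _)
    | seq rs => exact steps_bulletList (by simpa using ha) (by simpa using hb)

lemma steps_star {a b : NFRep G} (ha : a ≠ .seq []) (hb : b ≠ .seq []) :
    Steps domG codG (.par a.toTerm b.toTerm) (star domG codG a b).toTerm := by
  cases a with
  | id n =>
    cases b with
    | id m => exact .single (Step.r5 _ _)
    | seq rs => exact steps_id_par n (by simpa using hb)
  | seq ls =>
    have hls : ls ≠ [] := by simpa using ha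
    cases b with
    | id m => exact steps_par_id m hls
    | seq rs =>
      have hrs : rs ≠ [] := by simpa using hb
      refine .head (Step.r7 _ _ (layersToTerm_ne_id hls) (layersToTerm_ne_id hrs)) ?_
      rw [NFRep.toTerm, NFRep.toTerm, dom_layersToTerm, cod_layersToTerm]
      exact (Steps.seq_congr (steps_par_id _ hls) (steps_id_par _ hrs)).trans
        (steps_append (by simpa using hls) (by simpa using hrs))

lemma NFr_ne_seq_nil (t : PTerm G) : NFr domG codG t ≠ .seq [] := by
  induction t with
  | id n => simp [NFr]
  | gen g => simp [NFr]
  | seq u v hu hv => exact bullet_ne_seq_nil hu hv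
  | par u v hu hv => exact star_ne_seq_nil hu hv

/-- Every preprocessed term rewrites to its normal form. -/
lemma PP.steps_NFmap {t : PTerm G} (ht : PP domG codG t) :
    Steps domG codG t (NFmap domG codG t) := by
  rw [NFmap_eq_toTerm]
  induction ht with
  | id n => exact .refl
  | layer k g ℓ =>
    have : (NFr domG codG (layer k g ℓ)).toTerm = layer k g ℓ := by
      simp [layer, NFr, _root_.star, NFRep.toTerm, layersToTerm]
    rw [this]
    exact .refl
  | seq _ _ _ hu hv =>
    exact (Steps.seq_congr hu hv).trans (steps_bullet (NFr_ne_seq_nil _) (NFr_ne_seq_nil _))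
  | par _ _ hu hv =>
    exact (Steps.par_congr hu hv).trans (steps_star (NFr_ne_seq_nil _) (NFr_ne_seq_nil _))

end Joinability

/-- Main Theorem: preprocessed terms with the same normal form are joinable by `R`,
so each can be transformed into the other by forward and backward `R`-steps. -/
theorem joinable_of_nf_eq {G : Type} (domG codG : G → ℕ)
    (hSig : ∀ g : G, 0 < domG g ∧ 0 < codG g)
    (t₁ t₂ : PTerm G) (h₁ : PP domG codG t₁) (h₂ : PP domG codG t₂)
    (h : NFmap domG codG t₁ = NFmap domG codG t₂) :
    ∃ u : PTerm G, Steps domG codG t₁ u ∧ Steps domG codG t₂ u :=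
  ⟨NFmap domG codG t₁, h₁.steps_NFmap, h ▸ h₂.steps_NFmap⟩
end

section
/- The layer commutation rule preserves β and decreases δ_D by at least 1/D: let g₁, g₂ ∈ Σ, k₁, k₂, ℓ₁, ℓ₂ ∈ ℕ with k₁ ≥ k₂ + dom(g₂), and let D ∈ ℕ satisfy D ≥ 2 + |def(g₁)| and D ≥ 2 + |def(g₂)|. Let L := ⟨k₁,g₁,ℓ₁⟩⨟⟨k₂,g₂,ℓ₂⟩ and R' := ⟨k₂,g₂,ℓ₂+def(g₁)⟩⨟⟨k₁−def(g₂),g₁,ℓ₁⟩ (well-defined: ℓ₂+def(g₁) ≥ 0 and k₁−def(g₂) ≥ 0 under the typing and side conditions). Then β(L) = β(R') and δ_D(L) ≥ δ_D(R') + 1/D; concretely, k₁ + k₂/D ≥ k₂ + (k₁−def(g₂))/D + 1/D. -/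
theorem beta_layer {G : Type} (k : ℕ) (g : G) (ℓ : ℕ) : beta (layer k g ℓ) = 200 := by
  simp [layer, beta]

theorem delta_layer {G : Type} (D k : ℕ) (g : G) (ℓ : ℕ) : delta D (layer k g ℓ) = k := by
  simp [layer, delta]

/-- Truncation of `k₁ + d - c` at `0` is harmless here. -/
theorem add_div_ge_of_commute {k₁ k₂ d c D : ℕ} (hd : 0 < d) (hk : k₁ ≥ k₂ + d)
    (hD : (D : ℤ) ≥ 2 + |(c : ℤ) - (d : ℤ)|) :
    (k₁ : ℝ) + (k₂ : ℝ) / D ≥ (k₂ : ℝ) + ((k₁ + d - c : ℕ) : ℝ) / D + 1 / D := by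
  have habs := neg_abs_le ((c : ℤ) - d)
  have hD_two : (2 : ℤ) ≤ D := by linarith [abs_nonneg ((c : ℤ) - d)]
  have hD_pos : (0 : ℝ) < D := by exact_mod_cast (by omega : 0 < D)
  have key : (k₂ : ℤ) * D + (k₁ + d - c : ℕ) + 1 ≤ k₁ * D + k₂ := by
    have hgap : (1 : ℤ) ≤ k₁ - k₂ := by omega
    have hmul : (D : ℤ) - 1 ≤ (k₁ - k₂) * (D - 1) := by nlinarith
    have hsub : ((k₁ + d - c : ℕ) : ℤ) ≤ k₁ + D - 2 := by omega
    linarith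
  have key_real : (k₂ : ℝ) * D + (k₁ + d - c : ℕ) + 1 ≤ k₁ * D + k₂ := by exact_mod_cast key
  have hdiv := div_le_div_of_nonneg_right key_real hD_pos.le
  rwa [add_div, add_div, add_div, mul_div_cancel_right₀ _ hD_pos.ne',
    mul_div_cancel_right₀ _ hD_pos.ne'] at hdiv

/-- The layer commutation rule preserves `β` and decreases `δ_D` by at least `1/D`;
concretely `k₁ + k₂/D ≥ k₂ + (k₁ - def(g₂))/D + 1/D`. -/
theorem layer_commutation_measure {G : Type} (domG codG : G → ℕ)
    (hSig : ∀ g : G, 0 < domG g ∧ 0 < codG g)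
    (g₁ g₂ : G) (k₁ k₂ ℓ₁ ℓ₂ D : ℕ)
    (hcond : k₁ ≥ k₂ + domG g₂)
    (htype : k₁ + codG g₁ + ℓ₁ = k₂ + domG g₂ + ℓ₂)
    (hD₁ : (D : ℤ) ≥ 2 + |(codG g₁ : ℤ) - (domG g₁ : ℤ)|)
    (hD₂ : (D : ℤ) ≥ 2 + |(codG g₂ : ℤ) - (domG g₂ : ℤ)|) :
    beta (.seq (layer k₁ g₁ ℓ₁) (layer k₂ g₂ ℓ₂) : PTerm G) =
      beta (.seq (layer k₂ g₂ (ℓ₂ + codG g₁ - domG g₁))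
                 (layer (k₁ + domG g₂ - codG g₂) g₁ ℓ₁) : PTerm G) ∧
    delta D (.seq (layer k₁ g₁ ℓ₁) (layer k₂ g₂ ℓ₂) : PTerm G) ≥
      delta D (.seq (layer k₂ g₂ (ℓ₂ + codG g₁ - domG g₁))
                    (layer (k₁ + domG g₂ - codG g₂) g₁ ℓ₁) : PTerm G) + 1 / D ∧
    (k₁ : ℝ) + (k₂ : ℝ) / D ≥
      (k₂ : ℝ) + ((k₁ + domG g₂ - codG g₂ : ℕ) : ℝ) / D + 1 / D := by
  have hmeasure := add_div_ge_of_commute (hSig g₂).1 hcond hD₂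
  refine ⟨by simp only [beta, beta_layer], ?_, hmeasure⟩
  simpa only [delta, delta_layer] using hmeasure
end
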